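/- arXiv:solv-int/9705011 — 12 statements merged into one kernel-verified Lean document; each statement's English description precedes it below -/
import Mathlib

section
/- Let V : ℝ → ℝ be differentiable, λ ∈ ℝ, and let f, g, h : ℝ → ℂ be differentiable functions satisfying the determining system f'(x) = iλ(g(x) − h(x)), g'(x) = 2iλf(x) + 2g(x)V(x), h'(x) = −2iλf(x) − 2h(x)V(x). If u₁, u₂ : ℝ → ℂ satisfy the Dirac system u₁' = Vu₁ − iλu₂, u₂' = −Vu₂ − iλu₁, then the functions v₁ := f·u₁ + g·u₂ and v₂ := h·u₁ − f·u₂ also satisfy the Dirac system: v₁' = Vv₁ − iλv₂ and v₂' = −Vv₂ − iλv₁. (That is, the matrix η = [[f, g],[h, −f]] is a Lie symmetry of the Dirac equation: it maps solutions to solutions.) -/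
open Complex

/-- If `(f, g, h)` solves the determining system for Lie symmetries of the Dirac
equation, then `η = [[f, g],[h, -f]]` maps solutions of the Dirac system to
solutions: `v₁ = f u₁ + g u₂`, `v₂ = h u₁ - f u₂` again solve the Dirac system. -/
theorem dirac_lie_symmetry_maps_solutions
    (V : ℝ → ℝ) (l : ℝ) (f g h u₁ u₂ : ℝ → ℂ)
    (hV : Differentiable ℝ V)
    (hf : Differentiable ℝ f) (hg : Differentiable ℝ g) (hh : Differentiable ℝ h)
    (hu₁ : Differentiable ℝ u₁) (hu₂ : Differentiable ℝ u₂)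
    (hdf : ∀ x, deriv f x = I * l * (g x - h x))
    (hdg : ∀ x, deriv g x = 2 * I * l * f x + 2 * g x * (V x : ℂ))
    (hdh : ∀ x, deriv h x = -(2 * I * l * f x) - 2 * h x * (V x : ℂ))
    (hd₁ : ∀ x, deriv u₁ x = (V x : ℂ) * u₁ x - I * l * u₂ x)
    (hd₂ : ∀ x, deriv u₂ x = -(V x : ℂ) * u₂ x - I * l * u₁ x) :
    (∀ x, deriv (fun y => f y * u₁ y + g y * u₂ y) x
        = (V x : ℂ) * (f x * u₁ x + g x * u₂ x)
          - I * l * (h x * u₁ x - f x * u₂ x)) ∧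
    (∀ x, deriv (fun y => h y * u₁ y - f y * u₂ y) x
        = -(V x : ℂ) * (h x * u₁ x - f x * u₂ x)
          - I * l * (f x * u₁ x + g x * u₂ x)) := by
  constructor
  · intro x
    have H := ((hf x).hasDerivAt.mul (hu₁ x).hasDerivAt).add
      ((hg x).hasDerivAt.mul (hu₂ x).hasDerivAt)
    refine Eq.trans (HasDerivAt.deriv H) ?_
    rw [hdf, hdg, hd₁, hd₂]
    ring
  · intro x
    have H := ((hh x).hasDerivAt.mul (hu₁ x).hasDerivAt).sub
      ((hf x).hasDerivAt.mul (hu₂ x).hasDerivAt)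
    refine Eq.trans (HasDerivAt.deriv H) ?_
    rw [hdf, hdh, hd₁, hd₂]
    ring
end

section
/- Let V : ℝ → ℝ be differentiable, λ ∈ ℝ, and let f, g, h : ℝ → ℂ be differentiable functions satisfying the determining system f'(x) = iλ(g(x) − h(x)), g'(x) = 2iλf(x) + 2g(x)V(x), h'(x) = −2iλf(x) − 2h(x)V(x). Then the quantity Δ(x) := f(x)² + g(x)h(x) is constant on ℝ (its derivative vanishes identically). -/
open Complex

/-- The quantity `Δ = f² + g h` is a first integral of the determining system
`f' = iλ(g - h)`, `g' = 2iλ f + 2 g V`, `h' = -2iλ f - 2 h V`: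
its derivative vanishes identically, so it is constant on ℝ. -/
theorem dirac_determining_first_integral
    (V : ℝ → ℝ) (l : ℝ) (f g h : ℝ → ℂ)
    (hV : Differentiable ℝ V)
    (hf : Differentiable ℝ f) (hg : Differentiable ℝ g) (hh : Differentiable ℝ h)
    (hdf : ∀ x, deriv f x = I * l * (g x - h x))
    (hdg : ∀ x, deriv g x = 2 * I * l * f x + 2 * g x * (V x : ℂ))
    (hdh : ∀ x, deriv h x = -(2 * I * l * f x) - 2 * h x * (V x : ℂ)) :
    ∀ x, deriv (fun y => f y ^ 2 + g y * h y) x = 0 := by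
  intro x
  have h1 := ((hf x).hasDerivAt.pow 2).add ((hg x).hasDerivAt.mul (hh x).hasDerivAt)
  have h2 : deriv (fun y => f y ^ 2 + g y * h y) x = _ := h1.deriv
  rw [h2, hdf, hdg, hdh]
  push_cast
  ring
end

section
/- Let λ ∈ ℝ, δ, C₂ ∈ ℂ, let h : ℝ → ℂ be a nonvanishing continuous function, and let B : ℝ → ℂ be differentiable with B'(x) = 1/h(x) for all x. Define R(x) := δ · tanh(C₂ − iλδB(x)). Then at every point x where cosh(C₂ − iλδB(x)) ≠ 0, R is differentiable and satisfies the Riccati equation R'(x) = iλ(R(x)² − δ²)/h(x). -/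
open Complex

/-- `R(x) = δ tanh(C₂ - iλδ B(x))` with `B' = 1/h` solves the Riccati equation
`R' = iλ(R² - δ²)/h` wherever `cosh(C₂ - iλδ B(x)) ≠ 0`. -/
theorem riccati_tanh_solution
    (l : ℝ) (δ C₂ : ℂ) (h B : ℝ → ℂ)
    (hh : Continuous h) (hh0 : ∀ x, h x ≠ 0)
    (hB : ∀ x, HasDerivAt B (1 / h x) x)
    (R : ℝ → ℂ)
    (hR : R = fun x => δ * Complex.tanh (C₂ - I * l * δ * B x)) :
    ∀ x, Complex.cosh (C₂ - I * l * δ * B x) ≠ 0 →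
      HasDerivAt R (I * l * (R x ^ 2 - δ ^ 2) / h x) x := by
  intro x hc
  have hu : HasDerivAt (fun y : ℝ => C₂ - I * l * δ * B y) (-(I * l * δ * (1 / h x))) x :=
    ((hB x).const_mul (I * l * δ)).const_sub C₂
  have ht : HasDerivAt (fun z : ℂ => Complex.sinh z / Complex.cosh z) _
      (C₂ - I * l * δ * B x) :=
    (Complex.hasDerivAt_sinh _).div (Complex.hasDerivAt_cosh _) hc
  have hfin := (HasDerivAt.comp x ht hu).const_mul δ
  subst hR
  have hfun : (fun y : ℝ => δ * Complex.tanh (C₂ - I * l * δ * B y)) =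
      fun y : ℝ => δ * ((fun z : ℂ => Complex.sinh z / Complex.cosh z) ∘
        (fun y : ℝ => C₂ - I * l * δ * B y)) y := by
    funext y
    simp only [Function.comp, Complex.tanh_eq_sinh_div_cosh]
  rw [hfun]
  refine hfin.congr_deriv ?_
  have hx := hh0 x
  simp only [Function.comp]
  generalize C₂ - I * l * δ * B x = u at hc ⊢
  field_simp
  ring
end

section
/- Let λ ∈ ℝ, δ, C₂ ∈ ℂ, let h : ℝ → ℂ be a nonvanishing continuous function, and let B : ℝ → ℂ be differentiable with B'(x) = 1/h(x) for all x. Define R(x) := δ · tan(C₂ + iλδB(x)). Then at every point x where cos(C₂ + iλδB(x)) ≠ 0, R is differentiable and satisfies the Riccati equation R'(x) = iλ(R(x)² + δ²)/h(x). -/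
open Complex

/-- `R(x) = δ tan(C₂ + iλδ B(x))` with `B' = 1/h` solves the Riccati equation
`R' = iλ(R² + δ²)/h` wherever `cos(C₂ + iλδ B(x)) ≠ 0`. -/
theorem riccati_tan_solution
    (l : ℝ) (δ C₂ : ℂ) (h B : ℝ → ℂ)
    (hh : Continuous h) (hh0 : ∀ x, h x ≠ 0)
    (hB : ∀ x, HasDerivAt B (1 / h x) x)
    (R : ℝ → ℂ)
    (hR : R = fun x => δ * Complex.tan (C₂ + I * l * δ * B x)) :
    ∀ x, Complex.cos (C₂ + I * l * δ * B x) ≠ 0 →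
      HasDerivAt R (I * l * (R x ^ 2 + δ ^ 2) / h x) x := by
  intro x hc
  subst hR
  have h1 : HasDerivAt (fun y : ℝ => C₂ + I * l * δ * B y) (I * l * δ * (1 / h x)) x :=
    ((hB x).const_mul (I * l * δ)).const_add C₂
  have h2 := ((Complex.hasDerivAt_tan hc).comp x h1).const_mul δ
  refine h2.congr_deriv ?_
  have hx := hh0 x
  have hs := Complex.sin_sq_add_cos_sq (C₂ + I * l * δ * B x)
  simp only [Complex.tan_eq_sin_div_cos]
  generalize Complex.cos (C₂ + I * l * δ * B x) = c at *
  generalize Complex.sin (C₂ + I * l * δ * B x) = s at *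
  have h3 : (δ * (s / c)) ^ 2 + δ ^ 2 = δ ^ 2 * (1 / c ^ 2) := by
    rw [← hs]
    field_simp
  rw [h3]
  ring
end

section
/- Let V : ℝ → ℝ be differentiable, λ ∈ ℝ, d, C₁ ∈ ℂ, and let f, g, h : ℝ → ℂ be differentiable functions satisfying the determining system f' = iλ(g − h), g' = 2iλf + 2gV, h' = −2iλf − 2hV, with f(x)² + g(x)h(x) = d for all x. Let R : ℝ → ℂ be differentiable with R'(x) = iλ(R(x)² − d)/h(x), and let p, q : ℝ → ℂ be differentiable nonvanishing functions with p(x)² = h(x) and q(x)² = R(x)² − d for all x. Then u₁(x) := C₁(R(x) + f(x))/(p(x)q(x)) and u₂(x) := C₁ p(x)/q(x) satisfy the Dirac system u₁' = Vu₁ − iλu₂, u₂' = −Vu₂ − iλu₁ on ℝ. -/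
open Complex

/-- Lemma 1 (core formula): given a solution `(f, g, h)` of the determining system
with constant first integral `f² + g h = d`, a solution `R` of the Riccati equation
`R' = iλ(R² - d)/h`, and differentiable branches `p = √h`, `q = √(R² - d)`, the
functions `u₁ = C₁ (R + f)/(p q)` and `u₂ = C₁ p/q` solve the Dirac system. -/
theorem dirac_general_solution
    (V : ℝ → ℝ) (l : ℝ) (d C₁ : ℂ) (f g h : ℝ → ℂ)
    (hV : Differentiable ℝ V)
    (hf : Differentiable ℝ f) (hg : Differentiable ℝ g) (hh : Differentiable ℝ h)
    (hdf : ∀ x, deriv f x = I * l * (g x - h x))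
    (hdg : ∀ x, deriv g x = 2 * I * l * f x + 2 * g x * (V x : ℂ))
    (hdh : ∀ x, deriv h x = -(2 * I * l * f x) - 2 * h x * (V x : ℂ))
    (hΔ : ∀ x, f x ^ 2 + g x * h x = d)
    (R : ℝ → ℂ) (hR : ∀ x, HasDerivAt R (I * l * (R x ^ 2 - d) / h x) x)
    (p q : ℝ → ℂ)
    (hp : Differentiable ℝ p) (hq : Differentiable ℝ q)
    (hp0 : ∀ x, p x ≠ 0) (hq0 : ∀ x, q x ≠ 0)
    (hp2 : ∀ x, p x ^ 2 = h x) (hq2 : ∀ x, q x ^ 2 = R x ^ 2 - d)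
    (u₁ u₂ : ℝ → ℂ)
    (hu₁ : u₁ = fun x => C₁ * (R x + f x) / (p x * q x))
    (hu₂ : u₂ = fun x => C₁ * p x / q x) :
    ∀ x, HasDerivAt u₁ ((V x : ℂ) * u₁ x - I * l * u₂ x) x ∧
         HasDerivAt u₂ (-(V x : ℂ) * u₂ x - I * l * u₁ x) x := by
  intro x
  have P0 := hp0 x
  have Q0 := hq0 x
  have Df := (hf x).hasDerivAt
  rw [hdf x] at Df
  have DR := hR x
  rw [← hq2 x, ← hp2 x] at DR
  have Dp : HasDerivAt p (-(I * l * f x) / p x - p x * (V x : ℂ)) x := by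
    have h1 := (hp x).hasDerivAt
    have h2 := (h1.pow 2)
    have e : p ^ 2 = h := funext hp2
    rw [e] at h2
    have h3 := h2.unique (hh x).hasDerivAt
    rw [hdh x, ← hp2 x] at h3
    refine h1.congr_deriv ?_
    field_simp
    norm_num at h3
    linear_combination (1 / 2) * h3
  have Dq : HasDerivAt q (I * l * R x * q x / p x ^ 2) x := by
    have h1 := (hq x).hasDerivAt
    have h2 := (h1.pow 2)
    have e : q ^ 2 = fun y => (R ^ 2) y - d := funext hq2
    rw [e] at h2
    have h3 := h2.unique ((DR.pow 2).sub_const d)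
    refine h1.congr_deriv ?_
    norm_num at h3
    field_simp at h3 ⊢
    linear_combination h3
  have hG : g x = (d - f x ^ 2) / p x ^ 2 := by
    rw [eq_div_iff (pow_ne_zero 2 P0), hp2 x]
    linear_combination hΔ x
  have hd : d = R x ^ 2 - q x ^ 2 := by linear_combination hq2 x
  subst hu₁ hu₂
  constructor
  · refine HasDerivAt.congr_deriv (((DR.add Df).const_mul C₁).div (Dp.mul Dq) (mul_ne_zero P0 Q0)) ?_
    simp only [Pi.add_apply, Pi.mul_apply]
    rw [hG, hd, ← hp2 x]
    field_simp
    ring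
  · refine HasDerivAt.congr_deriv ((Dp.const_mul C₁).div Dq Q0) ?_
    field_simp
    ring
end

section
/- (Lemma 1, case Δ > 0.) Let V : ℝ → ℝ be differentiable, λ ∈ ℝ, C₁, C₂ ∈ ℂ, and let f, g, h : ℝ → ℂ be differentiable functions satisfying the determining system f' = iλ(g − h), g' = 2iλf + 2gV, h' = −2iλf − 2hV, such that Δ := f² + gh is identically equal to a real constant d > 0; set δ := √d. Let B : ℝ → ℂ be differentiable with B' = 1/h, define R(x) := δ·tanh(C₂ − iλδB(x)), and suppose cosh(C₂ − iλδB(x)) ≠ 0 for all x. Let p, q : ℝ → ℂ be differentiable nonvanishing functions with p² = h and q² = R² − d. Then u₁ := C₁(R + f)/(pq) and u₂ := C₁p/q satisfy the Dirac system u₁' = Vu₁ − iλu₂, u₂' = −Vu₂ − iλu₁ on ℝ. -/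
open Complex

/-- Lemma 1, case `Δ > 0`: with `Δ = f² + g h ≡ d > 0`, `δ = √d`,
`R = δ tanh(C₂ - iλδ B)` where `B' = 1/h`, and branches `p = √h`, `q = √(R² - d)`,
the functions `u₁ = C₁ (R + f)/(p q)`, `u₂ = C₁ p/q` solve the Dirac system. -/
theorem dirac_solution_delta_pos
    (V : ℝ → ℝ) (l : ℝ) (C₁ C₂ : ℂ) (d : ℝ) (hd : 0 < d)
    (f g h : ℝ → ℂ)
    (hV : Differentiable ℝ V)
    (hf : Differentiable ℝ f) (hg : Differentiable ℝ g) (hh : Differentiable ℝ h)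
    (hdf : ∀ x, deriv f x = I * l * (g x - h x))
    (hdg : ∀ x, deriv g x = 2 * I * l * f x + 2 * g x * (V x : ℂ))
    (hdh : ∀ x, deriv h x = -(2 * I * l * f x) - 2 * h x * (V x : ℂ))
    (hΔ : ∀ x, f x ^ 2 + g x * h x = (d : ℂ))
    (δ : ℂ) (hδ : δ = (Real.sqrt d : ℂ))
    (B : ℝ → ℂ) (hB : ∀ x, HasDerivAt B (1 / h x) x)
    (R : ℝ → ℂ)
    (hR : R = fun x => δ * Complex.tanh (C₂ - I * l * δ * B x))
    (hcosh : ∀ x, Complex.cosh (C₂ - I * l * δ * B x) ≠ 0)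
    (p q : ℝ → ℂ)
    (hp : Differentiable ℝ p) (hq : Differentiable ℝ q)
    (hp0 : ∀ x, p x ≠ 0) (hq0 : ∀ x, q x ≠ 0)
    (hp2 : ∀ x, p x ^ 2 = h x) (hq2 : ∀ x, q x ^ 2 = R x ^ 2 - (d : ℂ))
    (u₁ u₂ : ℝ → ℂ)
    (hu₁ : u₁ = fun x => C₁ * (R x + f x) / (p x * q x))
    (hu₂ : u₂ = fun x => C₁ * p x / q x) :
    ∀ x, HasDerivAt u₁ ((V x : ℂ) * u₁ x - I * l * u₂ x) x ∧
         HasDerivAt u₂ (-(V x : ℂ) * u₂ x - I * l * u₁ x) x := by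
  intro x
  have hδ2 : δ ^ 2 = (d : ℂ) := by
    rw [hδ, ← Complex.ofReal_pow, Real.sq_sqrt hd.le]
  have hp0x := hp0 x
  have hq0x := hq0 x
  have hh0 : h x ≠ 0 := by rw [← hp2 x]; exact pow_ne_zero 2 hp0x
  -- derivative of R
  have hRd : HasDerivAt R (I * l * q x ^ 2 / p x ^ 2) x := by
    have hw : HasDerivAt (fun y => C₂ - I * l * δ * B y) (-(I * l * δ * (1 / h x))) x :=
      ((hB x).const_mul (I * l * δ)).const_sub C₂
    have hc := hcosh x
    have hs := (Complex.hasDerivAt_sinh (C₂ - I * l * δ * B x)).comp x hw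
    have hcc := (Complex.hasDerivAt_cosh (C₂ - I * l * δ * B x)).comp x hw
    have ht := (hs.div hcc hc).const_mul δ
    have hRe : R = fun y => δ * ((Complex.sinh ∘ fun y => C₂ - I * l * δ * B y) /
        (Complex.cosh ∘ fun y => C₂ - I * l * δ * B y)) y := by
      rw [hR]; funext y
      simp [Complex.tanh_eq_sinh_div_cosh]
    rw [hRe]
    refine ht.congr_deriv ?_
    rw [hq2 x, hp2 x, hR, ← hδ2]
    simp only [Complex.tanh_eq_sinh_div_cosh, Function.comp]
    generalize Complex.cosh (C₂ - I * l * δ * B x) = c at hc ⊢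
    generalize Complex.sinh (C₂ - I * l * δ * B x) = s
    field_simp
    ring
  have hfd : HasDerivAt f (I * l * (g x - h x)) x := hdf x ▸ (hf x).hasDerivAt
  have hpd : HasDerivAt p ((-(I * l * f x) - p x ^ 2 * V x) / p x) x := by
    have h1 := (hp x).hasDerivAt
    have h2 : HasDerivAt h _ x := (funext hp2 : p ^ 2 = h) ▸ h1.pow 2
    have h3 := h2.unique (hdh x ▸ (hh x).hasDerivAt)
    refine h1.congr_deriv ?_
    rw [eq_div_iff hp0x, hp2 x]
    simp at h3
    linear_combination h3 / 2
  have hqd : HasDerivAt q (I * l * R x * q x / p x ^ 2) x := by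
    have h1 := (hq x).hasDerivAt
    have h2 : HasDerivAt (fun y => R y ^ 2 - (d : ℂ)) _ x :=
      (funext hq2 : q ^ 2 = fun y => R y ^ 2 - (d : ℂ)) ▸ h1.pow 2
    have h3 := h2.unique ((hRd.pow 2).sub_const (d : ℂ))
    refine h1.congr_deriv ?_
    simp at h3
    field_simp at h3 ⊢
    linear_combination h3
  have hg' : g x = (R x ^ 2 - q x ^ 2 - f x ^ 2) / p x ^ 2 := by
    rw [eq_div_iff (pow_ne_zero 2 hp0x), hq2 x, hp2 x]
    linear_combination hΔ x
  constructor
  · rw [hu₁, hu₂]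
    refine (((hRd.add hfd).const_mul C₁).div (hpd.mul hqd) (mul_ne_zero hp0x hq0x)).congr_deriv ?_
    simp only [Pi.add_apply, Pi.mul_apply]
    rw [hg', ← hp2 x]
    field_simp
    ring
  · rw [hu₁, hu₂]
    refine ((hpd.const_mul C₁).div hqd hq0x).congr_deriv ?_
    field_simp
    ring
end

section
/- (Lemma 1, case Δ = 0.) Let V : ℝ → ℝ be differentiable, λ ∈ ℝ, C₁, C₂ ∈ ℂ, and let f, g, h : ℝ → ℂ be differentiable functions satisfying the determining system f' = iλ(g − h), g' = 2iλf + 2gV, h' = −2iλf − 2hV, such that f² + gh vanishes identically. Let B : ℝ → ℂ be differentiable with B' = 1/h, define R(x) := (C₂ − iλB(x))⁻¹, and suppose C₂ − iλB(x) ≠ 0 for all x. Let p, q : ℝ → ℂ be differentiable nonvanishing functions with p² = h and q² = R². Then u₁ := C₁(R + f)/(pq) and u₂ := C₁p/q satisfy the Dirac system u₁' = Vu₁ − iλu₂, u₂' = −Vu₂ − iλu₁ on ℝ. -/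
open Complex

/-- Lemma 1, case `Δ = 0`: with `f² + g h ≡ 0`, `R = (C₂ - iλ B)⁻¹` where `B' = 1/h`,
and branches `p = √h`, `q = √(R²)`, the functions `u₁ = C₁ (R + f)/(p q)`,
`u₂ = C₁ p/q` solve the Dirac system. -/
theorem dirac_solution_delta_zero
    (V : ℝ → ℝ) (l : ℝ) (C₁ C₂ : ℂ)
    (f g h : ℝ → ℂ)
    (hV : Differentiable ℝ V)
    (hf : Differentiable ℝ f) (hg : Differentiable ℝ g) (hh : Differentiable ℝ h)
    (hdf : ∀ x, deriv f x = I * l * (g x - h x))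
    (hdg : ∀ x, deriv g x = 2 * I * l * f x + 2 * g x * (V x : ℂ))
    (hdh : ∀ x, deriv h x = -(2 * I * l * f x) - 2 * h x * (V x : ℂ))
    (hΔ : ∀ x, f x ^ 2 + g x * h x = 0)
    (B : ℝ → ℂ) (hB : ∀ x, HasDerivAt B (1 / h x) x)
    (R : ℝ → ℂ)
    (hR : R = fun x => (C₂ - I * l * B x)⁻¹)
    (hne : ∀ x, C₂ - I * l * B x ≠ 0)
    (p q : ℝ → ℂ)
    (hp : Differentiable ℝ p) (hq : Differentiable ℝ q)
    (hp0 : ∀ x, p x ≠ 0) (hq0 : ∀ x, q x ≠ 0)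
    (hp2 : ∀ x, p x ^ 2 = h x) (hq2 : ∀ x, q x ^ 2 = R x ^ 2)
    (u₁ u₂ : ℝ → ℂ)
    (hu₁ : u₁ = fun x => C₁ * (R x + f x) / (p x * q x))
    (hu₂ : u₂ = fun x => C₁ * p x / q x) :
    ∀ x, HasDerivAt u₁ ((V x : ℂ) * u₁ x - I * l * u₂ x) x ∧
         HasDerivAt u₂ (-(V x : ℂ) * u₂ x - I * l * u₁ x) x := by
  intro x
  have hpx := hp0 x
  have hqx := hq0 x
  have hR' : HasDerivAt R (I * l * R x ^ 2 / p x ^ 2) x := by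
    have h1 := (((hB x).const_mul (I * (l : ℂ))).const_sub C₂).fun_inv (hne x)
    rw [← hR] at h1
    refine h1.congr_deriv ?_
    have h2 : R x = (C₂ - I * l * B x)⁻¹ := by rw [hR]
    rw [h2, hp2 x]
    simp only [div_eq_mul_inv, inv_pow]
    ring
  have hp' : deriv p x = -(I * l * f x) / p x - p x * (V x : ℂ) := by
    have h1 := (hp x).hasDerivAt.fun_pow 2
    have h2 : (fun y => p y ^ 2) = h := funext hp2
    rw [h2] at h1
    have h3 := h1.deriv
    rw [hdh x, ← hp2 x] at h3
    field_simp
    norm_num at h3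
    linear_combination (-1 / 2 : ℂ) * h3
  have hq' : deriv q x = I * l * R x * q x / p x ^ 2 := by
    have h1 := (hq x).hasDerivAt.fun_pow 2
    have h2 : (fun y => q y ^ 2) = fun y => R y ^ 2 := funext hq2
    rw [h2] at h1
    have h3 := h1.unique (hR'.fun_pow 2)
    norm_num at h3
    apply mul_left_cancel₀ hqx
    have e : q x * (I * l * R x * q x / p x ^ 2) = I * l * R x * q x ^ 2 / p x ^ 2 := by ring
    rw [e, hq2 x]
    linear_combination (1 / 2 : ℂ) * h3
  have hP := (hp x).hasDerivAt
  have hQ := (hq x).hasDerivAt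
  have hF := (hf x).hasDerivAt
  have hg' : g x = -(f x ^ 2) / p x ^ 2 := by
    have := hΔ x
    rw [← hp2 x] at this
    field_simp
    linear_combination this
  rw [hp'] at hP
  rw [hq'] at hQ
  rw [hdf x, hg', ← hp2 x] at hF
  constructor
  · have h1 := ((hR'.fun_add hF).const_mul C₁).fun_div (hP.fun_mul hQ) (mul_ne_zero hpx hqx)
    rw [hu₁, hu₂]
    refine h1.congr_deriv ?_
    field_simp
    ring
  · have h1 := (hP.const_mul C₁).fun_div hQ hqx
    rw [hu₁, hu₂]
    refine h1.congr_deriv ?_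
    field_simp
    ring
end

section
/- (Lemma 1, case Δ < 0.) Let V : ℝ → ℝ be differentiable, λ ∈ ℝ, C₁, C₂ ∈ ℂ, and let f, g, h : ℝ → ℂ be differentiable functions satisfying the determining system f' = iλ(g − h), g' = 2iλf + 2gV, h' = −2iλf − 2hV, such that Δ := f² + gh is identically equal to a real constant d < 0; set δ := √(−d). Let B : ℝ → ℂ be differentiable with B' = 1/h, define R(x) := δ·tan(C₂ + iλδB(x)), and suppose cos(C₂ + iλδB(x)) ≠ 0 for all x. Let p, q : ℝ → ℂ be differentiable nonvanishing functions with p² = h and q² = R² − d. Then u₁ := C₁(R + f)/(pq) and u₂ := C₁p/q satisfy the Dirac system u₁' = Vu₁ − iλu₂, u₂' = −Vu₂ − iλu₁ on ℝ. -/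
open Complex

/-- Lemma 1, case `Δ < 0`: with `Δ = f² + g h ≡ d < 0`, `δ = √(-d)`,
`R = δ tan(C₂ + iλδ B)` where `B' = 1/h`, and branches `p = √h`, `q = √(R² - d)`,
the functions `u₁ = C₁ (R + f)/(p q)`, `u₂ = C₁ p/q` solve the Dirac system. -/
theorem dirac_solution_delta_neg
    (V : ℝ → ℝ) (l : ℝ) (C₁ C₂ : ℂ) (d : ℝ) (hd : d < 0)
    (f g h : ℝ → ℂ)
    (hV : Differentiable ℝ V)
    (hf : Differentiable ℝ f) (hg : Differentiable ℝ g) (hh : Differentiable ℝ h)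
    (hdf : ∀ x, deriv f x = I * l * (g x - h x))
    (hdg : ∀ x, deriv g x = 2 * I * l * f x + 2 * g x * (V x : ℂ))
    (hdh : ∀ x, deriv h x = -(2 * I * l * f x) - 2 * h x * (V x : ℂ))
    (hΔ : ∀ x, f x ^ 2 + g x * h x = (d : ℂ))
    (δ : ℂ) (hδ : δ = (Real.sqrt (-d) : ℂ))
    (B : ℝ → ℂ) (hB : ∀ x, HasDerivAt B (1 / h x) x)
    (R : ℝ → ℂ)
    (hR : R = fun x => δ * Complex.tan (C₂ + I * l * δ * B x))
    (hcos : ∀ x, Complex.cos (C₂ + I * l * δ * B x) ≠ 0)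
    (p q : ℝ → ℂ)
    (hp : Differentiable ℝ p) (hq : Differentiable ℝ q)
    (hp0 : ∀ x, p x ≠ 0) (hq0 : ∀ x, q x ≠ 0)
    (hp2 : ∀ x, p x ^ 2 = h x) (hq2 : ∀ x, q x ^ 2 = R x ^ 2 - (d : ℂ))
    (u₁ u₂ : ℝ → ℂ)
    (hu₁ : u₁ = fun x => C₁ * (R x + f x) / (p x * q x))
    (hu₂ : u₂ = fun x => C₁ * p x / q x) :
    ∀ x, HasDerivAt u₁ ((V x : ℂ) * u₁ x - I * l * u₂ x) x ∧
         HasDerivAt u₂ (-(V x : ℂ) * u₂ x - I * l * u₁ x) x := by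
  intro x
  have hδ2 : δ ^ 2 = -(d : ℂ) := by
    rw [hδ, ← Complex.ofReal_pow, Real.sq_sqrt (by linarith)]
    push_cast
    rfl
  have hpx := hp0 x
  have hqx := hq0 x
  have hh2 : h x = p x ^ 2 := (hp2 x).symm
  have hRd : HasDerivAt R (I * l * q x ^ 2 / p x ^ 2) x := by
    have h1 : HasDerivAt (fun x => C₂ + I * l * δ * B x) (I * l * δ * (1 / h x)) x :=
      ((hB x).const_mul (I * l * δ)).const_add C₂
    have h2 := ((Complex.hasDerivAt_tan (hcos x)).comp x h1).const_mul δ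
    have h3 := h2.congr_of_eventuallyEq (Filter.EventuallyEq.of_eq hR)
    refine h3.congr_deriv ?_
    rw [hq2 x, hR, ← hp2 x]
    have hd' : (d : ℂ) = -δ ^ 2 := by rw [hδ2]; ring
    have hc := hcos x
    have hsc := Complex.sin_sq_add_cos_sq (C₂ + I * l * δ * B x)
    simp only [hd', Complex.tan_eq_sin_div_cos]
    generalize Complex.sin (C₂ + I * l * δ * B x) = s at *
    generalize Complex.cos (C₂ + I * l * δ * B x) = c at *
    field_simp
    linear_combination (-(l * δ ^ 2)) * hsc
  have hpd : HasDerivAt p (-(I * l * f x) / p x - p x * V x) x := by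
    refine (hp x).hasDerivAt.congr_deriv ?_
    have h1 := (hp x).hasDerivAt.pow 2
    have e : p ^ 2 = h := funext hp2
    rw [e] at h1
    have h2 := h1.deriv
    rw [hdh x, hh2] at h2
    field_simp
    norm_num at h2
    linear_combination (-1 / 2) * h2
  have hqd : HasDerivAt q (I * l * R x * q x / p x ^ 2) x := by
    refine (hq x).hasDerivAt.congr_deriv ?_
    have h1 := (hq x).hasDerivAt.pow 2
    have e : q ^ 2 = fun y => R y ^ 2 - (d : ℂ) := funext hq2
    rw [e] at h1
    have h2 := h1.unique ((hRd.pow 2).sub_const (d : ℂ))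
    norm_num at h2
    field_simp at h2 ⊢
    linear_combination h2
  have hfd : HasDerivAt f (I * l * (g x - h x)) x := by
    rw [← hdf x]
    exact (hf x).hasDerivAt
  constructor
  · have h1 := ((hRd.add hfd).const_mul C₁).div (hpd.mul hqd) (mul_ne_zero hpx hqx)
    have h2 := h1.congr_of_eventuallyEq (Filter.EventuallyEq.of_eq hu₁)
    refine h2.congr_deriv ?_
    have hD := hΔ x
    have hQ := hq2 x
    rw [hu₁, hu₂]
    simp only [Pi.add_apply, Pi.mul_apply]
    rw [hh2] at hD ⊢
    field_simp
    linear_combination C₁ * I * l * (hQ + hD)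
  · have h1 := (hpd.const_mul C₁).div hqd hqx
    have h2 := h1.congr_of_eventuallyEq (Filter.EventuallyEq.of_eq hu₂)
    refine h2.congr_deriv ?_
    rw [hu₁, hu₂]
    simp only []
    field_simp
    ring
end

section
/- Let V : ℝ → ℝ be differentiable, λ ∈ ℝ with λ ≠ 0, and let ψ₁, ψ₂ : ℝ → ℂ be twice differentiable. Define f := (i/(4λ))(−ψ₁' + 2Vψ₂), g := (ψ₁ + ψ₂)/2, h := (ψ₂ − ψ₁)/2. Then (f, g, h) satisfies the determining system f' = iλ(g − h), g' = 2iλf + 2gV, h' = −2iλf − 2hV if and only if (ψ₁, ψ₂) satisfies the system ψ₁''(x) = −4λ²ψ₁(x) + 2V(x)ψ₂'(x) + 2V'(x)ψ₂(x) and ψ₂'(x) = 2V(x)ψ₁(x) for all x ∈ ℝ. -/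
open Complex

/-- The substitution `f = (i/(4λ))(-ψ₁' + 2Vψ₂)`, `g = (ψ₁ + ψ₂)/2`, `h = (ψ₂ - ψ₁)/2`
transforms the determining system `f' = iλ(g - h)`, `g' = 2iλf + 2gV`, `h' = -2iλf - 2hV`
into the equivalent second-order system `ψ₁'' = -4λ²ψ₁ + 2Vψ₂' + 2V'ψ₂`, `ψ₂' = 2Vψ₁`. -/
theorem determining_system_second_order_form
    (V : ℝ → ℝ) (l : ℝ) (hl : l ≠ 0) (ψ₁ ψ₂ : ℝ → ℂ)
    (hV : Differentiable ℝ V)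
    (hψ₁ : Differentiable ℝ ψ₁) (hψ₁' : Differentiable ℝ (deriv ψ₁))
    (hψ₂ : Differentiable ℝ ψ₂) (hψ₂' : Differentiable ℝ (deriv ψ₂))
    (f g h : ℝ → ℂ)
    (hf : f = fun x => I / (4 * l) * (-(deriv ψ₁ x) + 2 * (V x : ℂ) * ψ₂ x))
    (hg : g = fun x => (ψ₁ x + ψ₂ x) / 2)
    (hh : h = fun x => (ψ₂ x - ψ₁ x) / 2) :
    ((∀ x, deriv f x = I * l * (g x - h x)) ∧
     (∀ x, deriv g x = 2 * I * l * f x + 2 * g x * (V x : ℂ)) ∧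
     (∀ x, deriv h x = -(2 * I * l * f x) - 2 * h x * (V x : ℂ))) ↔
    ((∀ x, deriv (deriv ψ₁) x = -(4 * (l : ℂ) ^ 2) * ψ₁ x
        + 2 * (V x : ℂ) * deriv ψ₂ x + 2 * ((deriv V x : ℝ) : ℂ) * ψ₂ x) ∧
     (∀ x, deriv ψ₂ x = 2 * (V x : ℂ) * ψ₁ x)) := by
  have hlc : (l : ℂ) ≠ 0 := by exact_mod_cast hl
  have hdf : ∀ x, deriv f x = I / (4 * l) * (-(deriv (deriv ψ₁) x)
      + (2 * ((deriv V x : ℝ) : ℂ) * ψ₂ x + 2 * (V x : ℂ) * deriv ψ₂ x)) := by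
    intro x
    rw [hf]
    have h1 := (hψ₁' x).hasDerivAt
    have h2 := (hψ₂ x).hasDerivAt
    have h3 := (hV x).hasDerivAt.ofReal_comp
    exact ((h1.neg.add ((h3.const_mul (2 : ℂ)).mul h2)).const_mul (I / (4 * (l : ℂ)))).deriv
  have hdg : ∀ x, deriv g x = (deriv ψ₁ x + deriv ψ₂ x) / 2 := by
    intro x
    rw [hg]
    exact (((hψ₁ x).hasDerivAt.add (hψ₂ x).hasDerivAt).div_const 2).deriv
  have hdh : ∀ x, deriv h x = (deriv ψ₂ x - deriv ψ₁ x) / 2 := by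
    intro x
    rw [hh]
    exact (((hψ₂ x).hasDerivAt.sub (hψ₁ x).hasDerivAt).div_const 2).deriv
  have hlf : ∀ x, 2 * I * l * f x = deriv ψ₁ x / 2 - (V x : ℂ) * ψ₂ x := by
    intro x
    have e : 2 * I * (l : ℂ) * (I / (4 * l)) = -1 / 2 := by
      field_simp
      rw [I_sq]
      ring
    rw [hf]
    linear_combination (-(deriv ψ₁ x) + 2 * (V x : ℂ) * ψ₂ x) * e
  have e1 : (I / (4 * (l : ℂ))) * (-4 * I * l) = 1 := by
    field_simp
    rw [I_sq]
    ring
  have e2 : (I / (4 * (l : ℂ))) * (4 * l) = I := by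
    field_simp
  have hgx : ∀ x, g x = (ψ₁ x + ψ₂ x) / 2 := fun x => by rw [hg]
  have hhx : ∀ x, h x = (ψ₂ x - ψ₁ x) / 2 := fun x => by rw [hh]
  simp only [hdf, hdg, hdh, hlf, hgx, hhx]
  constructor
  · rintro ⟨A, B, _⟩
    refine ⟨fun x => ?_, fun x => ?_⟩
    · linear_combination (4 * I * l) * A x
        + (-(deriv (deriv ψ₁) x) + (2 * ((deriv V x : ℝ) : ℂ) * ψ₂ x
          + 2 * (V x : ℂ) * deriv ψ₂ x)) * e1 + 4 * (l : ℂ) ^ 2 * ψ₁ x * I_sq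
    · linear_combination 2 * B x
  · rintro ⟨A, B⟩
    refine ⟨fun x => ?_, fun x => ?_, fun x => ?_⟩
    · linear_combination (-(I / (4 * (l : ℂ)))) * A x + l * ψ₁ x * e2
    · linear_combination B x / 2
    · linear_combination B x / 2
end

section
/- Let V : ℝ → ℝ be smooth, x₀ ∈ ℝ, and define recursively S₁ := V' and S_{i+1}(x) := −S_i''(x) + 4V'(x)∫_{x₀}^{x} V(y)S_i(y)dy + 4V(x)²S_i(x). Let n ≥ 2 and let C₁, ..., Cₙ ∈ ℂ be constants. Define pₙ := 0, p_{n−k}(x) := Σ_{i=1}^{k} C_i S_{k+1−i}(x) for k = 1, ..., n−1, and r_{n−k}(x) := 2Σ_{i=1}^{k} C_i ∫_{x₀}^{x} V(y)S_{k+1−i}(y)dy + C_{k+1}/2 for k = 0, ..., n−1 (so rₙ = C₁/2). Then these functions satisfy rₖ' = 2Vpₖ for k = 1, ..., n and p_{k−1} = −pₖ'' + 2Vrₖ' + 2V'rₖ for k = 2, ..., n; moreover, the remaining bottom equation 0 = −p₁'' + 2Vr₁' + 2V'r₁ holds if and only if V satisfies the stationary mKdV hierarchy equation Σ_{i=1}^{n}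 C_i S_{n+1−i}(x) = 0 for all x. -/
open Complex

/-- Auxiliary sequence: `mkdvSAux V x₀ 0 = V'` and
`mkdvSAux V x₀ (i+1) = Q (mkdvSAux V x₀ i)` where
`Q = -d²/dx² + 4 V' D⁻¹ V + 4V²` is the recursion operator of the mKdV equation
(with integration from the base point `x₀`). -/
noncomputable def mkdvSAux (V : ℝ → ℝ) (x₀ : ℝ) : ℕ → ℝ → ℝ
  | 0 => deriv V
  | i + 1 => fun x =>
      -(deriv (deriv (mkdvSAux V x₀ i)) x)
      + 4 * deriv V x * (∫ y in x₀..x, V y * mkdvSAux V x₀ i y)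
      + 4 * V x ^ 2 * mkdvSAux V x₀ i x

/-- The higher mKdV symmetries `S₁ = V'`, `S_{i+1} = Q S_i`, indexed from 1. -/
noncomputable def mkdvS (V : ℝ → ℝ) (x₀ : ℝ) (i : ℕ) : ℝ → ℝ :=
  mkdvSAux V x₀ (i - 1)

lemma mkdvAux_int (V : ℝ → ℝ) (hV : Continuous V) (x₀ : ℝ) (f : ℝ → ℝ) (hf : Continuous f) (x : ℝ) :
    HasDerivAt (fun x => ∫ y in x₀..x, V y * f y) (V x * f x) x := by
  have h : Continuous fun y => V y * f y := hV.mul hf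
  exact intervalIntegral.integral_hasDerivAt_right (h.intervalIntegrable _ _)
    (h.stronglyMeasurableAtFilter _ _) h.continuousAt

lemma mkdvAux_smooth (V : ℝ → ℝ) (hV : ContDiff ℝ (⊤ : ℕ∞) V) (x₀ : ℝ) (i : ℕ) :
    ContDiff ℝ (⊤ : ℕ∞) (mkdvSAux V x₀ i) := by
  have hd : ∀ f : ℝ → ℝ, ContDiff ℝ (⊤ : ℕ∞) f → ContDiff ℝ (⊤ : ℕ∞) (deriv f) :=
    fun f hf => (contDiff_infty_iff_deriv.1 hf).2
  induction i with
  | zero => exact hd V hV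
  | succ i ih =>
    have hI : ContDiff ℝ (⊤ : ℕ∞) (fun x => ∫ y in x₀..x, V y * mkdvSAux V x₀ i y) := by
      have h := mkdvAux_int V hV.continuous x₀ _ ih.continuous
      refine contDiff_infty_iff_deriv.2 ⟨fun x => (h x).differentiableAt, ?_⟩
      have : deriv (fun x => ∫ y in x₀..x, V y * mkdvSAux V x₀ i y)
          = fun x => V x * mkdvSAux V x₀ i x := funext fun x => (h x).deriv
      rw [this]
      exact hV.mul ih
    exact (((hd _ (hd _ ih)).neg).add ((contDiff_const.mul (hd V hV)).mul hI)).add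
      ((contDiff_const.mul (hV.pow 2)).mul ih)

/-- The general combination of functions occurring as `p`. -/
noncomputable def mkdvP (V : ℝ → ℝ) (x₀ : ℝ) (C : ℕ → ℂ) (k : ℕ) : ℝ → ℂ := fun x =>
  ∑ i ∈ Finset.Icc 1 k, C i * (mkdvS V x₀ (k + 1 - i) x : ℂ)

/-- The general combination of functions occurring as `r`. -/
noncomputable def mkdvR (V : ℝ → ℝ) (x₀ : ℝ) (C : ℕ → ℂ) (k : ℕ) : ℝ → ℂ := fun x =>
  2 * ∑ i ∈ Finset.Icc 1 k,
    C i * ((∫ y in x₀..x, V y * mkdvS V x₀ (k + 1 - i) y : ℝ) : ℂ) + C (k + 1) / 2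

lemma mkdvR_deriv (V : ℝ → ℝ) (hV : ContDiff ℝ (⊤ : ℕ∞) V) (x₀ : ℝ) (C : ℕ → ℂ) (k : ℕ) (x : ℝ) :
    deriv (mkdvR V x₀ C k) x = 2 * (V x : ℂ) * mkdvP V x₀ C k x := by
  have h : HasDerivAt (mkdvR V x₀ C k) (2 * ∑ i ∈ Finset.Icc 1 k,
      C i * ((V x * mkdvS V x₀ (k + 1 - i) x : ℝ) : ℂ)) x := by
    refine ((HasDerivAt.fun_sum fun i _ => ?_).const_mul 2).add_const _
    exact ((mkdvAux_int V hV.continuous x₀ _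
      (mkdvAux_smooth V hV x₀ _).continuous x).ofReal_comp).const_mul (C i)
  rw [h.deriv, mkdvP, Finset.mul_sum, Finset.mul_sum]
  refine Finset.sum_congr rfl fun i _ => ?_
  push_cast
  ring

lemma mkdvP_deriv2 (V : ℝ → ℝ) (hV : ContDiff ℝ (⊤ : ℕ∞) V) (x₀ : ℝ) (C : ℕ → ℂ) (k : ℕ) (x : ℝ) :
    deriv (deriv (mkdvP V x₀ C k)) x = ∑ i ∈ Finset.Icc 1 k,
      C i * ((deriv (deriv (mkdvS V x₀ (k + 1 - i))) x : ℝ) : ℂ) := by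
  have hS := fun i => contDiff_infty_iff_deriv.1 (mkdvAux_smooth V hV x₀ i)
  have h1 : deriv (mkdvP V x₀ C k) = fun x => ∑ i ∈ Finset.Icc 1 k,
      C i * ((deriv (mkdvS V x₀ (k + 1 - i)) x : ℝ) : ℂ) := by
    funext x
    refine HasDerivAt.deriv (HasDerivAt.fun_sum fun i _ => ?_)
    exact (((hS _).1 x).hasDerivAt.ofReal_comp).const_mul (C i)
  rw [h1]
  refine HasDerivAt.deriv (HasDerivAt.fun_sum fun i _ => ?_)
  exact (((contDiff_infty_iff_deriv.1 (hS _).2).1 x).hasDerivAt.ofReal_comp).const_mul (C i)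

lemma mkdvP_succ (V : ℝ → ℝ) (hV : ContDiff ℝ (⊤ : ℕ∞) V) (x₀ : ℝ) (C : ℕ → ℂ) (k : ℕ) (x : ℝ) :
    mkdvP V x₀ C (k + 1) x = -(deriv (deriv (mkdvP V x₀ C k)) x)
      + 2 * (V x : ℂ) * deriv (mkdvR V x₀ C k) x
      + 2 * ((deriv V x : ℝ) : ℂ) * mkdvR V x₀ C k x := by
  rw [mkdvP_deriv2 V hV, mkdvR_deriv V hV]
  unfold mkdvP mkdvR
  rw [Finset.sum_Icc_succ_top (by omega)]
  have h0 : mkdvS V x₀ (k + 1 + 1 - (k + 1)) x = deriv V x := by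
    have : k + 1 + 1 - (k + 1) = 1 := by omega
    rw [this]; rfl
  have h : ∀ i ∈ Finset.Icc 1 k, C i * (mkdvS V x₀ (k + 1 + 1 - i) x : ℂ)
      = -(C i * ((deriv (deriv (mkdvS V x₀ (k + 1 - i))) x : ℝ) : ℂ))
      + 4 * ((deriv V x : ℝ) : ℂ) * (C i * ((∫ y in x₀..x, V y * mkdvS V x₀ (k + 1 - i) y : ℝ) : ℂ))
      + 4 * (V x : ℂ) ^ 2 * (C i * (mkdvS V x₀ (k + 1 - i) x : ℂ)) := by
    intro i hi
    rw [Finset.mem_Icc] at hi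
    have e : mkdvS V x₀ (k + 1 + 1 - i) x = -(deriv (deriv (mkdvS V x₀ (k + 1 - i))) x)
      + 4 * deriv V x * (∫ y in x₀..x, V y * mkdvS V x₀ (k + 1 - i) y)
      + 4 * V x ^ 2 * mkdvS V x₀ (k + 1 - i) x := by
      have e1 : k + 1 + 1 - i - 1 = (k + 1 - i - 1) + 1 := by omega
      unfold mkdvS
      rw [e1]; rfl
    rw [e, Complex.ofReal_add, Complex.ofReal_add, Complex.ofReal_neg, Complex.ofReal_mul,
      Complex.ofReal_mul, Complex.ofReal_mul, Complex.ofReal_mul, Complex.ofReal_pow]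
    push_cast
    ring
  rw [Finset.sum_congr rfl h, h0, Finset.sum_add_distrib, Finset.sum_add_distrib,
    Finset.sum_neg_distrib, ← Finset.mul_sum, ← Finset.mul_sum]
  ring

/-- The explicit coefficients `p_{n-k} = Σ_{i=1}^{k} C_i S_{k+1-i}`,
`r_{n-k} = 2 Σ_{i=1}^{k} C_i ∫ V S_{k+1-i} + C_{k+1}/2` (with `pₙ = 0`, `rₙ = C₁/2`)
satisfy the recurrences `rₖ' = 2Vpₖ` and `p_{k-1} = -pₖ'' + 2Vrₖ' + 2V'rₖ`, and the
bottom equation `0 = -p₁'' + 2Vr₁' + 2V'r₁` holds iff `V` satisfies the stationary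
mKdV hierarchy equation `Σ_{i=1}^{n} C_i S_{n+1-i} = 0`. -/
theorem ansatz_coefficients_and_stationary_mkdv
    (V : ℝ → ℝ) (hV : ContDiff ℝ (⊤ : ℕ∞) V) (x₀ : ℝ)
    (n : ℕ) (hn : 2 ≤ n) (C : ℕ → ℂ) (p r : ℕ → ℝ → ℂ)
    (hpn : p n = 0)
    (hpdef : ∀ k ∈ Finset.Icc 1 (n - 1), ∀ x,
      p (n - k) x = ∑ i ∈ Finset.Icc 1 k, C i * (mkdvS V x₀ (k + 1 - i) x : ℂ))
    (hrdef : ∀ k ∈ Finset.Icc 0 (n - 1), ∀ x,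
      r (n - k) x = 2 * ∑ i ∈ Finset.Icc 1 k,
          C i * ((∫ y in x₀..x, V y * mkdvS V x₀ (k + 1 - i) y : ℝ) : ℂ)
        + C (k + 1) / 2) :
    (∀ k ∈ Finset.Icc 1 n, ∀ x, deriv (r k) x = 2 * (V x : ℂ) * p k x) ∧
    (∀ k ∈ Finset.Icc 2 n, ∀ x,
      p (k - 1) x = -(deriv (deriv (p k)) x) + 2 * (V x : ℂ) * deriv (r k) x
        + 2 * ((deriv V x : ℝ) : ℂ) * r k x) ∧
    ((∀ x, (0 : ℂ) = -(deriv (deriv (p 1)) x) + 2 * (V x : ℂ) * deriv (r 1) x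
        + 2 * ((deriv V x : ℝ) : ℂ) * r 1 x) ↔
     (∀ x, ∑ i ∈ Finset.Icc 1 n, C i * (mkdvS V x₀ (n + 1 - i) x : ℂ) = 0)) := by
  have hp : ∀ k ≤ n - 1, p (n - k) = mkdvP V x₀ C k := by
    intro k hk
    rcases Nat.eq_zero_or_pos k with rfl | h
    · funext x
      simp [hpn, mkdvP]
    · funext x
      exact hpdef k (Finset.mem_Icc.2 ⟨h, hk⟩) x
  have hr : ∀ k ≤ n - 1, r (n - k) = mkdvR V x₀ C k := by
    intro k hk
    funext x
    exact hrdef k (Finset.mem_Icc.2 ⟨Nat.zero_le _, hk⟩) x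
  have hp' : ∀ k, 1 ≤ k → k ≤ n → p k = mkdvP V x₀ C (n - k) := by
    intro k h1 h2
    rw [← hp (n - k) (by omega), Nat.sub_sub_self h2]
  have hr' : ∀ k, 1 ≤ k → k ≤ n → r k = mkdvR V x₀ C (n - k) := by
    intro k h1 h2
    rw [← hr (n - k) (by omega), Nat.sub_sub_self h2]
  refine ⟨?_, ?_, ?_⟩
  · intro k hk x
    rw [Finset.mem_Icc] at hk
    rw [hp' k hk.1 hk.2, hr' k hk.1 hk.2]
    exact mkdvR_deriv V hV x₀ C _ x
  · intro k hk x
    rw [Finset.mem_Icc] at hk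
    rw [hp' k (by omega) hk.2, hr' k (by omega) hk.2, hp' (k - 1) (by omega) (by omega),
      ← mkdvP_succ V hV x₀ C _ x]
    congr 1
    omega
  · rw [hp' 1 le_rfl (by omega), hr' 1 le_rfl (by omega)]
    refine forall_congr' fun x => ?_
    rw [← mkdvP_succ V hV x₀ C _ x, Nat.sub_add_cancel (by omega)]
    exact eq_comm
end

section
/- Let V : ℝ → ℝ be three times differentiable, a ∈ ℝ, and suppose V satisfies the stationary mKdV equation V'''(x) = 6V(x)²V'(x) + aV'(x) for all x ∈ ℝ. Then for every λ ∈ ℝ with λ ≠ 0, the functions f(x) := (i/λ)(−V''(x) + 2V(x)³ + aV(x) + 4λ²V(x)), g(x) := 2V'(x) + 2V(x)² + a + 4λ², h(x) := −2V'(x) + 2V(x)² + a + 4λ² satisfy the determining system f' = iλ(g − h), g' = 2iλf + 2gV, h' = −2iλf − 2hV on ℝ. In particular, the Dirac equation with such a potential V admits a Lie symmetry for every nonzero λ. -/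
open Complex

/-- If `V` satisfies the stationary mKdV equation `V''' = 6V²V' + aV'`, then for every
`λ ≠ 0` the explicit triple `f = (i/λ)(-V'' + 2V³ + aV + 4λ²V)`,
`g = 2V' + 2V² + a + 4λ²`, `h = -2V' + 2V² + a + 4λ²` satisfies the determining
system `f' = iλ(g - h)`, `g' = 2iλf + 2gV`, `h' = -2iλf - 2hV`; in particular the
Dirac equation with such a potential admits a Lie symmetry for every nonzero `λ`. -/
theorem stationary_mkdv_symmetry_n_one
    (V : ℝ → ℝ) (a : ℝ)
    (hV : Differentiable ℝ V) (hV' : Differentiable ℝ (deriv V))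
    (hV'' : Differentiable ℝ (deriv (deriv V)))
    (hmkdv : ∀ x, deriv (deriv (deriv V)) x
      = 6 * V x ^ 2 * deriv V x + a * deriv V x)
    (l : ℝ) (hl : l ≠ 0) (f g h : ℝ → ℂ)
    (hf : f = fun x => I / l *
      (-((deriv (deriv V) x : ℝ) : ℂ) + 2 * (V x : ℂ) ^ 3 + (a : ℂ) * (V x : ℂ)
        + 4 * (l : ℂ) ^ 2 * (V x : ℂ)))
    (hg : g = fun x =>
      ((2 * deriv V x + 2 * V x ^ 2 + a + 4 * l ^ 2 : ℝ) : ℂ))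
    (hh : h = fun x =>
      ((-(2 * deriv V x) + 2 * V x ^ 2 + a + 4 * l ^ 2 : ℝ) : ℂ)) :
    ∀ x, HasDerivAt f (I * l * (g x - h x)) x ∧
         HasDerivAt g (2 * I * l * f x + 2 * g x * (V x : ℂ)) x ∧
         HasDerivAt h (-(2 * I * l * f x) - 2 * h x * (V x : ℂ)) x := by
  intro x
  have hl' : (l : ℂ) ≠ 0 := by exact_mod_cast hl
  have d0 : HasDerivAt V (deriv V x) x := (hV x).hasDerivAt
  have d1 : HasDerivAt (deriv V) (deriv (deriv V) x) x := (hV' x).hasDerivAt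
  have d2 : HasDerivAt (deriv (deriv V)) (6 * V x ^ 2 * deriv V x + a * deriv V x) x := by
    rw [← hmkdv x]
    exact (hV'' x).hasDerivAt
  have c0 := d0.ofReal_comp
  have c2 := d2.ofReal_comp
  have hI : I ^ 2 = -1 := I_sq
  subst hf hg hh
  refine ⟨?_, ?_, ?_⟩
  · have key := (((c2.neg.add ((c0.pow 3).const_mul (2 : ℂ))).add
      (c0.const_mul (a : ℂ))).add (c0.const_mul (4 * (l : ℂ) ^ 2))).const_mul (I / (l : ℂ))
    refine key.congr_deriv ?_
    push_cast
    field_simp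
    ring
  · have key := ((((d1.const_mul 2).add ((d0.pow 2).const_mul 2)).add_const a).add_const
      (4 * l ^ 2)).ofReal_comp
    refine key.congr_deriv ?_
    push_cast
    field_simp
    rw [hI]
    ring
  · have key := (((((d1.const_mul 2).neg).add ((d0.pow 2).const_mul 2)).add_const a).add_const
      (4 * l ^ 2)).ofReal_comp
    refine key.congr_deriv ?_
    push_cast
    field_simp
    rw [hI]
    ring
end

section
/- Let V : ℝ → ℝ be three times differentiable, a ∈ ℝ, and suppose V satisfies the stationary mKdV equation V''' = 6V²V' + aV' on ℝ. Fix λ ∈ ℝ with λ ≠ 0 and define f := (i/λ)(−V'' + 2V³ + aV + 4λ²V), g := 2V' + 2V² + a + 4λ², h := −2V' + 2V² + a + 4λ². Assume h is nonvanishing, let d ∈ ℂ be the (constant) value of f² + gh, let R : ℝ → ℂ be differentiable with R'(x) = iλ(R(x)² − d)/h(x), and let p, q : ℝ → ℂ be differentiable nonvanishing functions with p² = h and q² = R² − d. Then for every C₁ ∈ ℂ, the functions u₁ := C₁(R + f)/(pq) and u₂ := C₁p/q satisfy the Dirac system u₁' = Vu₁ − iλu₂, u₂' = −Vu₂ − iλu₁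 on ℝ. Thus the Dirac equation with potential satisfying the stationary mKdV equation is integrable by quadratures. -/
open Complex

/-- Integrability by quadratures of the Dirac equation whose potential satisfies the
stationary mKdV equation `V''' = 6V²V' + aV'`: with the Lie symmetry
`f = (i/λ)(-V'' + 2V³ + aV + 4λ²V)`, `g = 2V' + 2V² + a + 4λ²`,
`h = -2V' + 2V² + a + 4λ²`, the constant first integral `d = f² + gh`, a solution
`R` of the Riccati equation `R' = iλ(R² - d)/h` and branches `p = √h`,
`q = √(R² - d)`, the functions `u₁ = C₁(R + f)/(pq)`, `u₂ = C₁ p/q` solve the Dirac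
system `u₁' = Vu₁ - iλu₂`, `u₂' = -Vu₂ - iλu₁`. -/
theorem dirac_integrable_stationary_mkdv
    (V : ℝ → ℝ) (a : ℝ)
    (hV : Differentiable ℝ V) (hV' : Differentiable ℝ (deriv V))
    (hV'' : Differentiable ℝ (deriv (deriv V)))
    (hmkdv : ∀ x, deriv (deriv (deriv V)) x
      = 6 * V x ^ 2 * deriv V x + a * deriv V x)
    (l : ℝ) (hl : l ≠ 0) (f g h : ℝ → ℂ)
    (hf : f = fun x => I / l *
      (-((deriv (deriv V) x : ℝ) : ℂ) + 2 * (V x : ℂ) ^ 3 + (a : ℂ) * (V x : ℂ)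
        + 4 * (l : ℂ) ^ 2 * (V x : ℂ)))
    (hg : g = fun x =>
      ((2 * deriv V x + 2 * V x ^ 2 + a + 4 * l ^ 2 : ℝ) : ℂ))
    (hh : h = fun x =>
      ((-(2 * deriv V x) + 2 * V x ^ 2 + a + 4 * l ^ 2 : ℝ) : ℂ))
    (hh0 : ∀ x, h x ≠ 0)
    (d : ℂ) (hd : ∀ x, f x ^ 2 + g x * h x = d)
    (R : ℝ → ℂ) (hR : ∀ x, HasDerivAt R (I * l * (R x ^ 2 - d) / h x) x)
    (p q : ℝ → ℂ)
    (hp : Differentiable ℝ p) (hq : Differentiable ℝ q)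
    (hp0 : ∀ x, p x ≠ 0) (hq0 : ∀ x, q x ≠ 0)
    (hp2 : ∀ x, p x ^ 2 = h x) (hq2 : ∀ x, q x ^ 2 = R x ^ 2 - d)
    (C₁ : ℂ) (u₁ u₂ : ℝ → ℂ)
    (hu₁ : u₁ = fun x => C₁ * (R x + f x) / (p x * q x))
    (hu₂ : u₂ = fun x => C₁ * p x / q x) :
    ∀ x, HasDerivAt u₁ ((V x : ℂ) * u₁ x - I * l * u₂ x) x ∧
         HasDerivAt u₂ (-(V x : ℂ) * u₂ x - I * l * u₁ x) x := by
  intro x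
  have hlc : (l : ℂ) ≠ 0 := by exact_mod_cast hl
  have hI : I ^ 2 = -1 := I_sq
  have dV : HasDerivAt (fun y => (V y : ℂ)) ((deriv V x : ℝ) : ℂ) x :=
    (hV x).hasDerivAt.ofReal_comp
  have dV1 : HasDerivAt (fun y => ((deriv V y : ℝ) : ℂ)) ((deriv (deriv V) x : ℝ) : ℂ) x :=
    (hV' x).hasDerivAt.ofReal_comp
  have dV2 : HasDerivAt (fun y => ((deriv (deriv V) y : ℝ) : ℂ))
      ((6 * V x ^ 2 * deriv V x + a * deriv V x : ℝ) : ℂ) x := by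
    rw [← hmkdv x]
    exact (hV'' x).hasDerivAt.ofReal_comp
  have df : HasDerivAt f (I * l * (g x - h x)) x := by
    have := (((dV2.neg.add ((dV.pow 3).const_mul 2)).add (dV.const_mul (a : ℂ))).add
      (dV.const_mul (4 * (l : ℂ) ^ 2))).const_mul (I / (l : ℂ))
    rw [hf]
    refine this.congr_deriv ?_
    rw [hg, hh]
    push_cast
    field_simp
    ring
  have dh : HasDerivAt h (-(2 * I * l * f x) - 2 * h x * V x) x := by
    have := ((((dV1.const_mul 2).neg.add ((dV.pow 2).const_mul 2)).add_const (a : ℂ)).add_const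
      (4 * (l : ℂ) ^ 2))
    have e : h = fun y => -(2 * ((deriv V y : ℝ) : ℂ)) + 2 * (V y : ℂ) ^ 2 + (a : ℂ)
        + 4 * (l : ℂ) ^ 2 := by
      rw [hh]; funext y; push_cast; ring
    rw [e]
    refine this.congr_deriv ?_
    rw [hf]
    push_cast
    field_simp
    rw [hI]
    ring
  have hpx := hp0 x
  have hqx := hq0 x
  have dp : HasDerivAt p ((-(I * l * f x) - h x * V x) / p x) x := by
    have h1 := ((hp x).hasDerivAt.pow 2)
    have e : (p ^ 2) = h := funext hp2
    rw [e] at h1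
    have h2 := h1.unique dh
    refine (hp x).hasDerivAt.congr_deriv ?_
    rw [eq_div_iff hpx]
    push_cast at h2
    linear_combination h2 / 2
  have dq : HasDerivAt q (I * l * R x * q x / h x) x := by
    have h1 := ((hq x).hasDerivAt.pow 2)
    have e : (q ^ 2) = fun y => R y ^ 2 - d := funext hq2
    rw [e] at h1
    have h2 := h1.unique (((hR x).pow 2).sub_const d)
    refine (hq x).hasDerivAt.congr_deriv ?_
    rw [← hq2 x] at h2
    have hhx := hh0 x
    apply mul_left_cancel₀ hqx
    push_cast at h2
    field_simp at h2 ⊢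
    linear_combination h2
  have hdx := hd x
  have hpp := hp2 x
  have hqq := hq2 x
  constructor
  · have := ((((hR x).add df).const_mul C₁).div (dp.mul dq) (mul_ne_zero hpx hqx))
    rw [hu₁, hu₂]
    refine this.congr_deriv ?_
    simp only [Pi.add_apply, Pi.mul_apply]
    rw [← hpp, ← hdx, ← hpp]
    field_simp
    ring
  · have := (dp.const_mul C₁).div dq hqx
    rw [hu₁, hu₂]
    refine this.congr_deriv ?_
    rw [← hpp]
    field_simp
    ring
end
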